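/- Let φ be a (2,3)-CNF formula with n variables (each clause exactly two literals, each variable in at least 2 and at most 3 clauses), and let T_φ be the Tournament Value Maximization instance obtained from φ by Construction 2. If T_φ admits a tournament seeding whose tournament value is at least k + n, then φ admits a truth assignment satisfying at least k clauses. -/

import Mathlib

/-- Players are natural numbers; player `i` beats player `j` iff `i > j`.
Hence the winner of a (sub)tournament is its strongest player, i.e. the maximum
of the list of participating players. -/
def winner (l : List ℕ) : ℕ := l.foldr max 0

/-- The tournament value of the seeding given by the list `l` of players in
seed-position order (`l.length = 2 ^ m`), with respect to the game-value
function `v`: the value of a tournament on a single player is `0`; otherwise it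
is the value of the subtournament of the first half of the seed positions, plus
the value of the subtournament of the second half, plus `v i₁ i₂ m` where
`i₁, i₂` are the winners of the two halves playing each other in the final
round `m`. -/
def tourValue (v : ℕ → ℕ → ℕ → ℤ) : ℕ → List ℕ → ℤ
  | 0, _ => 0
  | m + 1, l =>
      tourValue v m (l.take (2 ^ m)) + tourValue v m (l.drop (2 ^ m)) +
        v (winner (l.take (2 ^ m))) (winner (l.drop (2 ^ m))) (m + 1)

/-- `l` is a tournament seeding for the player set `N` iff `l` lists the
elements of `N`, each exactly once, in seed-position order. -/
def IsSeeding (N : Finset ℕ) (l : List ℕ) : Prop := l.Nodup ∧ l.toFinset = N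

/-- The number of games won by player `i` in the tournament with `m` rounds on
the seeding `l`: in each (sub)tournament, the final game is won by the stronger
of the winners of the two halves. -/
def winCount (i : ℕ) : ℕ → List ℕ → ℕ
  | 0, _ => 0
  | m + 1, l =>
      winCount i m (l.take (2 ^ m)) + winCount i m (l.drop (2 ^ m)) +
        if i = max (winner (l.take (2 ^ m))) (winner (l.drop (2 ^ m))) then 1 else 0

/-- A clause with exactly two literals; a literal is a pair
(variable, polarity). -/
abbrev Clause2 := (ℕ × Bool) × (ℕ × Bool)

/-- The assignment `α` satisfies the clause `c` if it makes at least one of its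
two literals true. -/
def clauseSat (α : ℕ → Bool) (c : Clause2) : Bool :=
  (α c.1.1 == c.1.2) || (α c.2.1 == c.2.2)

/-- The number of clauses of `cs` satisfied by the assignment `α`. -/
def satCount (α : ℕ → Bool) (cs : List Clause2) : ℕ := cs.countP (clauseSat α)

/-- The list of all literal occurrences of the formula, in order. -/
def lits (cs : List Clause2) : List (ℕ × Bool) :=
  cs.foldr (fun c acc => c.1 :: c.2 :: acc) []

/-- `cs` is a (2,3)-CNF formula on the variables `1, …, n`: each clause has two
literals on two distinct variables from `{1, …, n}`, and each variable occurs
(equivalently, appears in) at least `2` and at most `3` clauses. -/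
def Good23 (n : ℕ) (cs : List Clause2) : Prop :=
  (∀ c ∈ cs, 1 ≤ c.1.1 ∧ c.1.1 ≤ n ∧ 1 ≤ c.2.1 ∧ c.2.1 ≤ n ∧ c.1.1 ≠ c.2.1) ∧
  (∀ x : ℕ, 1 ≤ x → x ≤ n →
      2 ≤ (lits cs).countP (fun p => p.1 == x) ∧
        (lits cs).countP (fun p => p.1 == x) ≤ 3)

/-- The total number of players `2 ^ n'`, where `n'` is the smallest integer
with `16 * n ≤ 2 ^ n'`.  The player set is `{0, 1, …, numP n - 1}` and the
`k`-th strongest player is the number `numP n - k`. -/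
def numP (n : ℕ) : ℕ := 2 ^ Nat.clog 2 (16 * n)

/-- The special player `d̂_i` (`i ∈ {1, …, n}`), of strength rank `3*i - 2`. -/
def dHat (n i : ℕ) : ℕ := numP n - (3 * i - 2)

/-- The special player `d_i`, of strength rank `3*i - 1`. -/
def dMid (n i : ℕ) : ℕ := numP n - (3 * i - 1)

/-- The special player `d̃_i`, of strength rank `3*i`. -/
def dTil (n i : ℕ) : ℕ := numP n - (3 * i)

/-- The variable player `x_i` (`i ∈ {1, …, n}`), of strength rank `3*n + 3*i - 2`. -/
def xPl (n i : ℕ) : ℕ := numP n - (3 * n + 3 * i - 2)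

/-- The variable player `x_i^T`, of strength rank `3*n + 3*i - 1`. -/
def xTPl (n i : ℕ) : ℕ := numP n - (3 * n + 3 * i - 1)

/-- The variable player `x_i^F`, of strength rank `3*n + 3*i`. -/
def xFPl (n i : ℕ) : ℕ := numP n - (3 * n + 3 * i)

/-- The clause player `c_j` (`j ∈ {1, …, m}`), of strength rank `6*n + j`;
the remaining numbers are the dummy players `f_1, …, f_{10n+p-m}`. -/
def cPl (n j : ℕ) : ℕ := numP n - (6 * n + j)

/-- The variable player corresponding to a literal: `x_i^T` for a positive and
`x_i^F` for a negative occurrence of `x_i`. -/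
def litPl (n : ℕ) (p : ℕ × Bool) : ℕ := if p.2 then xTPl n p.1 else xFPl n p.1

/-- The games of value `1` of Construction 2 (before symmetrisation):
`v (x_i) (x_i^T) = v (x_i) (x_i^F) = 1`, and `v c (x_i^T) = 1` when `x_i`
occurs positively in clause `c` and `v c (x_i^F) = 1` when `x_i` occurs
negatively in `c`. -/
def OneGame (n : ℕ) (cs : List Clause2) (a b : ℕ) : Prop :=
  (∃ i : ℕ, 1 ≤ i ∧ i ≤ n ∧ a = xPl n i ∧ (b = xTPl n i ∨ b = xFPl n i)) ∨
  (∃ j : ℕ, j < cs.length ∧ a = cPl n (j + 1) ∧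
      (b = litPl n (cs.getD j ((0, true), (0, true))).1 ∨
        b = litPl n (cs.getD j ((0, true), (0, true))).2))

/-- The explicitly zero-valued games of Construction 2 (before symmetrisation):
`v d_i (d̂_i) = v d_i (d̃_i) = v d_i (x_i) = 0`. -/
def ZeroGame (n a b : ℕ) : Prop :=
  ∃ i : ℕ, 1 ≤ i ∧ i ≤ n ∧ a = dMid n i ∧
    (b = dHat n i ∨ b = dTil n i ∨ b = xPl n i)

/-- `a` is one of the players `d_i` or `x_i` for some `i ∈ {1, …, n}`. -/
def DXPlayer (n a : ℕ) : Prop :=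
  ∃ i : ℕ, 1 ≤ i ∧ i ≤ n ∧ (a = dMid n i ∨ a = xPl n i)

open Classical in
/-- The (symmetric, round-oblivious) game-value function of Construction 2:
value `1` for the games described by `OneGame`; value `0` for the games
described by `ZeroGame`; value `-5` for every other game involving some `d_i`
or `x_i`; and value `0` for all remaining games. -/
noncomputable def gv2 (n : ℕ) (cs : List Clause2) (a b _r : ℕ) : ℤ :=
  if OneGame n cs a b ∨ OneGame n cs b a then 1
  else if ZeroGame n a b ∨ ZeroGame n b a then 0
  else if DXPlayer n a ∨ DXPlayer n b then -5
  else 0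

theorem le_winner {l : List ℕ} {p : ℕ} (hp : p ∈ l) : p ≤ winner l := by
  induction l with
  | nil => simp at hp
  | cons a t ih =>
    have hw : winner (a :: t) = max a (winner t) := rfl
    rcases List.mem_cons.1 hp with rfl | h
    · omega
    · have := ih h
      omega

theorem winner_mem {l : List ℕ} (hl : l ≠ []) : winner l ∈ l := by
  induction l with
  | nil => exact absurd rfl hl
  | cons a t ih =>
    have hw : winner (a :: t) = max a (winner t) := rfl
    rcases eq_or_ne t [] with rfl | ht
    · simp [winner]
    · rw [hw]
      rcases max_choice a (winner t) with h | h <;> rw [h]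
      · simp
      · exact List.mem_cons_of_mem _ (ih ht)

/-- The games played in the tournament with `m` rounds on the seeding `l`, as triples
`(winning player, losing player, round)`. -/
def tourGames : ℕ → List ℕ → Finset (ℕ × ℕ × ℕ)
  | 0, _ => ∅
  | m + 1, l =>
      insert (max (winner (l.take (2 ^ m))) (winner (l.drop (2 ^ m))),
          min (winner (l.take (2 ^ m))) (winner (l.drop (2 ^ m))), m + 1)
        (tourGames m (l.take (2 ^ m)) ∪ tourGames m (l.drop (2 ^ m)))

/-- The structural properties of the set `G` of games of a knockout tournament with `m` rounds on
the players in `l`. -/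
structure IsGameSet (m : ℕ) (l : List ℕ) (G : Finset (ℕ × ℕ × ℕ)) : Prop where
  bounds : ∀ a b r, (a, b, r) ∈ G → a ∈ l ∧ b ∈ l ∧ b < a ∧ 1 ≤ r ∧ r ≤ m
  loser_inj : ∀ a b r a' r', (a, b, r) ∈ G → (a', b, r') ∈ G → a = a' ∧ r = r'
  winner_inj : ∀ a b b' r, (a, b, r) ∈ G → (a, b', r) ∈ G → b = b'
  wins_before : ∀ a b r r', (a, b, r) ∈ G → 1 ≤ r' → r' ≤ r → ∃ c, (a, c, r') ∈ G
  champion_wins : ∀ r, 1 ≤ r → r ≤ m → ∃ c, (winner l, c, r) ∈ G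
  lt_of_loses : ∀ a b c r r', (a, b, r) ∈ G → (b, c, r') ∈ G → r' < r
  loses : ∀ p ∈ l, p ≠ winner l → ∃ a r, (a, p, r) ∈ G

theorem IsGameSet.insert_union {m : ℕ} {s t l : List ℕ} {G H : Finset (ℕ × ℕ × ℕ)}
    (hG : IsGameSet m s G) (hH : IsGameSet m t H) (hs : s ≠ []) (ht : t ≠ [])
    (hst : ∀ p ∈ s, p ∉ t) (hw : winner t < winner s) (hl : ∀ p, p ∈ l ↔ p ∈ s ∨ p ∈ t) :
    IsGameSet (m + 1) l (insert (winner s, winner t, m + 1) (G ∪ H)) := by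
  have hws := winner_mem hs
  have hwt := winner_mem ht
  have hwl : winner l = winner s := by
    apply le_antisymm
    · have : winner l ∈ l := winner_mem (List.ne_nil_of_mem ((hl _).2 (Or.inl hws)))
      rcases (hl _).1 this with h | h
      · exact le_winner h
      · exact (le_winner h).trans hw.le
    · exact le_winner ((hl _).2 (Or.inl hws))
  have hG0 := hG.bounds
  have hH0 := hH.bounds
  have hls : ∀ p ∈ s, p ≤ winner s := fun p => le_winner
  have hlt : ∀ p ∈ t, p ≤ winner t := fun p => le_winner
  have memI : ∀ a b r, (a, b, r) ∈ insert (winner s, winner t, m + 1) (G ∪ H) ↔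
      (a = winner s ∧ b = winner t ∧ r = m + 1) ∨ (a, b, r) ∈ G ∨ (a, b, r) ∈ H := by
    intro a b r
    simp [Prod.ext_iff]
  constructor
  · simp only [memI, hl]
    rintro a b r (⟨rfl, rfl, rfl⟩ | h | h)
    · grind
    · have := hG0 _ _ _ h
      grind
    · have := hH0 _ _ _ h
      grind
  · simp only [memI]
    have := hG.loser_inj
    have := hH.loser_inj
    grind
  · simp only [memI]
    have := hG.winner_inj
    have := hH.winner_inj
    grind
  · simp only [memI]
    have := hG.wins_before
    have := hH.wins_before
    have := hG.champion_wins
    rintro a b r r' (⟨rfl, rfl, rfl⟩ | h | h) h1 h2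
    · rcases h2.eq_or_lt with rfl | h2
      · exact ⟨winner t, by simp⟩
      · obtain ⟨c, hc⟩ := this r' h1 (by omega)
        exact ⟨c, by simp [hc]⟩
    · obtain ⟨c, hc⟩ := hG.wins_before a b r r' h h1 h2
      exact ⟨c, by simp [hc]⟩
    · obtain ⟨c, hc⟩ := hH.wins_before a b r r' h h1 h2
      exact ⟨c, by simp [hc]⟩
  · simp only [memI, hwl]
    intro r h1 h2
    rcases h2.eq_or_lt with rfl | h2
    · exact ⟨winner t, by simp⟩
    · obtain ⟨c, hc⟩ := hG.champion_wins r h1 (by omega)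
      exact ⟨c, by simp [hc]⟩
  · simp only [memI]
    have := hG.lt_of_loses
    have := hH.lt_of_loses
    grind
  · simp only [memI, hwl, hl]
    intro p hp hne
    rcases hp with hp | hp
    · obtain ⟨a, r, h⟩ := hG.loses p hp hne
      exact ⟨a, r, by simp [h]⟩
    · by_cases hpt : p = winner t
      · exact ⟨winner s, m + 1, by simp [hpt]⟩
      · obtain ⟨a, r, h⟩ := hH.loses p hp hpt
        exact ⟨a, r, by simp [h]⟩

theorem tourGames_spec (v : ℕ → ℕ → ℕ → ℤ) (hv : ∀ a b r, v a b r = v b a r) (m : ℕ) :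
    ∀ l : List ℕ, l.Nodup → l.length = 2 ^ m →
      IsGameSet m l (tourGames m l) ∧
        tourValue v m l = ∑ g ∈ tourGames m l, v g.1 g.2.1 g.2.2 := by
  induction m with
  | zero =>
    intro l _ hlen
    obtain ⟨p, rfl⟩ := List.length_eq_one_iff.1 hlen
    refine ⟨?_, by simp [tourValue, tourGames]⟩
    constructor <;> simp [tourGames, winner]
    omega
  | succ m ih =>
    intro l hnd hlen
    have hpow : 2 ^ (m + 1) = 2 ^ m + 2 ^ m := by ring
    have hpos : 0 < 2 ^ m := by positivity
    have hls : (l.take (2 ^ m)).length = 2 ^ m := by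
      rw [List.length_take]; omega
    have hlt : (l.drop (2 ^ m)).length = 2 ^ m := by
      rw [List.length_drop]; omega
    have hmem : ∀ p, p ∈ l ↔ p ∈ l.take (2 ^ m) ∨ p ∈ l.drop (2 ^ m) := by
      intro p
      rw [← List.mem_append, List.take_append_drop]
    have hdisj : ∀ p ∈ l.take (2 ^ m), p ∉ l.drop (2 ^ m) :=
      fun p hp hq => List.disjoint_take_drop hnd le_rfl hp hq
    have hnds : (l.take (2 ^ m)).Nodup := hnd.sublist (List.take_sublist _ _)
    have hndt : (l.drop (2 ^ m)).Nodup := hnd.sublist (List.drop_sublist _ _)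
    obtain ⟨hG, hsG⟩ := ih _ hnds hls
    obtain ⟨hH, hsH⟩ := ih _ hndt hlt
    rw [tourValue, tourGames, hsG, hsH]
    generalize l.take (2 ^ m) = s at *
    generalize l.drop (2 ^ m) = t at *
    have hs : s ≠ [] := List.ne_nil_of_length_pos (by omega)
    have ht : t ≠ [] := List.ne_nil_of_length_pos (by omega)
    have hne : winner s ≠ winner t :=
      fun h => hdisj _ (winner_mem hs) (h ▸ winner_mem ht)
    have hGH : Disjoint (tourGames m s) (tourGames m t) := by
      rw [Finset.disjoint_left]
      rintro ⟨a, b, r⟩ h1 h2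
      exact hdisj _ (hG.bounds _ _ _ h1).1 (hH.bounds _ _ _ h2).1
    constructor
    · rcases lt_or_gt_of_ne hne with h | h
      · rw [max_eq_right h.le, min_eq_left h.le, Finset.union_comm]
        exact hH.insert_union hG ht hs (fun p hp hq => hdisj p hq hp) h
          (fun p => (hmem p).trans or_comm)
      · rw [max_eq_left h.le, min_eq_right h.le]
        exact hG.insert_union hH hs ht hdisj h hmem
    · rw [Finset.sum_insert, Finset.sum_union hGH]
      · rcases lt_or_gt_of_ne hne with h | h
        · rw [max_eq_right h.le, min_eq_left h.le, hv (winner s)]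
          ring
        · rw [max_eq_left h.le, min_eq_right h.le]
          ring
      · intro h
        rcases Finset.mem_union.1 h with h | h
        · have := (hG.bounds _ _ _ h).2.2.2.2
          omega
        · have := (hH.bounds _ _ _ h).2.2.2.2
          omega

theorem card_filter_getD_eq_countP {β : Type*} (P : β → Bool) (d : β) (cs : List β) :
    ((Finset.range cs.length).filter (fun j => P (cs.getD j d) = true)).card = cs.countP P := by
  induction cs with
  | nil => simp
  | cons c t ih =>
    rw [Finset.card_filter] at ih ⊢
    rw [List.length_cons, Finset.sum_range_succ', List.countP_cons]
    simpa using ih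

theorem countP_le_countP_lits (i : ℕ) (cs : List Clause2) :
    cs.countP (fun c => c.1.1 == i || c.2.1 == i) ≤ (lits cs).countP (fun p => p.1 == i) := by
  induction cs with
  | nil => simp
  | cons c t ih =>
    have h : lits (c :: t) = c.1 :: c.2 :: lits t := rfl
    rw [h]
    simp only [List.countP_cons]
    grind

theorem length_eq_sum_countP {β : Type*} (f : β → ℕ) (S : Finset ℕ) (L : List β)
    (h : ∀ p ∈ L, f p ∈ S) : L.length = ∑ i ∈ S, L.countP (fun p => f p == i) := by
  induction L with
  | nil => simp
  | cons a t ih =>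
    have ha := h a (by simp)
    simp only [List.countP_cons, List.length_cons, Finset.sum_add_distrib]
    rw [← ih (fun p hp => h p (List.mem_cons_of_mem _ hp))]
    simp [ha]

theorem length_lits (cs : List Clause2) : (lits cs).length = 2 * cs.length := by
  induction cs with
  | nil => rfl
  | cons c t ih =>
    have h : lits (c :: t) = c.1 :: c.2 :: lits t := rfl
    rw [h]
    simp only [List.length_cons, ih]
    ring

theorem exists_of_mem_lits {cs : List Clause2} {p : ℕ × Bool} (hp : p ∈ lits cs) :
    ∃ c ∈ cs, p = c.1 ∨ p = c.2 := by
  induction cs with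
  | nil => simp [lits] at hp
  | cons c t ih =>
    have h : lits (c :: t) = c.1 :: c.2 :: lits t := rfl
    rw [h, List.mem_cons, List.mem_cons] at hp
    rcases hp with hp | hp | hp
    · exact ⟨c, by simp, Or.inl hp⟩
    · exact ⟨c, by simp, Or.inr hp⟩
    · obtain ⟨c', hc', h'⟩ := ih hp
      exact ⟨c', List.mem_cons_of_mem _ hc', h'⟩

theorem Good23.two_mul_length_le {n : ℕ} {cs : List Clause2} (h : Good23 n cs) :
    2 * cs.length ≤ 3 * n := by
  rw [← length_lits, length_eq_sum_countP Prod.fst (Finset.Icc 1 n)]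
  · calc _ ≤ ∑ _i ∈ Finset.Icc 1 n, 3 := by
          refine Finset.sum_le_sum fun i hi => ?_
          rw [Finset.mem_Icc] at hi
          exact (h.2 i hi.1 hi.2).2
      _ = 3 * n := by simp [mul_comm]
  · intro p hp
    obtain ⟨c, hc, hpc⟩ := exists_of_mem_lits hp
    have := h.1 c hc
    rw [Finset.mem_Icc]
    rcases hpc with rfl | rfl <;> omega

theorem le_numP (n : ℕ) : 16 * n ≤ numP n := Nat.le_pow_clog (by norm_num) _

theorem gv2_comm (n : ℕ) (cs : List Clause2) (a b r : ℕ) : gv2 n cs a b r = gv2 n cs b a r := by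
  unfold gv2
  grind

/-- The clause of index `j`. -/
abbrev clauseAt (cs : List Clause2) (j : ℕ) : Clause2 := cs.getD j ((0, true), (0, true))

/-- The games in which `x_i` beats `x_i^T` or `x_i^F`. -/
def VarGame (n i : ℕ) (g : ℕ × ℕ × ℕ) : Prop :=
  g.1 = xPl n i ∧ (g.2.1 = xTPl n i ∨ g.2.1 = xFPl n i)

/-- The games in which the player of the literal `p` beats a clause containing `p`. -/
def LitGame (n : ℕ) (cs : List Clause2) (p : ℕ × Bool) (g : ℕ × ℕ × ℕ) : Prop :=
  g.1 = litPl n p ∧ ∃ j < cs.length, g.2.1 = cPl n (j + 1) ∧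
    ((clauseAt cs j).1 = p ∨ (clauseAt cs j).2 = p)

/-- The index `i` of the players `d_i` and `x_i`. -/
def dxIndex (n a : ℕ) : ℕ :=
  if numP n - a ≤ 3 * n then (numP n - a + 1) / 3 else (numP n - a - 3 * n + 2) / 3

theorem dxIndex_dMid {n i : ℕ} (h1 : 1 ≤ i) (h2 : i ≤ n) : dxIndex n (dMid n i) = i := by
  have := le_numP n
  unfold dxIndex dMid
  split_ifs <;> omega

theorem dxIndex_xPl {n i : ℕ} (h1 : 1 ≤ i) (h2 : i ≤ n) : dxIndex n (xPl n i) = i := by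
  have := le_numP n
  unfold dxIndex xPl
  split_ifs <;> omega

theorem Good23.clauseAt_mem {n : ℕ} {cs : List Clause2} (h : Good23 n cs) {j : ℕ}
    (hj : j < cs.length) :
    1 ≤ (clauseAt cs j).1.1 ∧ (clauseAt cs j).1.1 ≤ n ∧
      1 ≤ (clauseAt cs j).2.1 ∧ (clauseAt cs j).2.1 ≤ n := by
  have hmem : clauseAt cs j ∈ cs := by
    simp [clauseAt, hj]
  have := h.1 _ hmem
  omega

theorem litPl_eq (n : ℕ) (p : ℕ × Bool) :
    litPl n p = numP n - (3 * n + 3 * p.1 - if p.2 then 1 else 0) := by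
  unfold litPl xTPl xFPl
  split_ifs <;> rfl

theorem litPl_inj {n : ℕ} {p q : ℕ × Bool} (hp : 1 ≤ p.1 ∧ p.1 ≤ n) (hq : 1 ≤ q.1 ∧ q.1 ≤ n)
    (h : litPl n p = litPl n q) : p = q := by
  have := le_numP n
  obtain ⟨i, b⟩ := p
  obtain ⟨i', b'⟩ := q
  simp only [litPl_eq] at h hp hq
  cases b <;> cases b' <;> simp at h ⊢ <;> omega

/-- A game of value `1`, won by the stronger player, is a `VarGame` or a `LitGame`. -/
theorem OneGame.exists {n : ℕ} {cs : List Clause2} (hgood : Good23 n cs) {a b r : ℕ} (hab : b < a)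
    (h : OneGame n cs a b ∨ OneGame n cs b a) :
    ∃ i ∈ Finset.Icc 1 n, VarGame n i (a, b, r) ∨ ∃ s, LitGame n cs (i, s) (a, b, r) := by
  have hN := le_numP n
  have hm := hgood.two_mul_length_le
  rcases h with (⟨i, h1, h2, ha, hb⟩ | ⟨j, hj, ha, hb⟩) | (⟨i, h1, h2, ha, hb⟩ | ⟨j, hj, ha, hb⟩)
  · exact ⟨i, Finset.mem_Icc.2 ⟨h1, h2⟩, Or.inl ⟨ha, hb⟩⟩
  · have := hgood.clauseAt_mem hj
    simp only [litPl_eq, cPl] at ha hb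
    simp only [clauseAt] at this
    rcases hb with hb | hb <;> split_ifs at hb <;> omega
  · unfold xPl at ha
    unfold xTPl xFPl at hb
    omega
  · have := hgood.clauseAt_mem hj
    rcases hb with hb | hb
    · exact ⟨(clauseAt cs j).1.1, Finset.mem_Icc.2 ⟨by omega, by omega⟩,
        Or.inr ⟨(clauseAt cs j).1.2, hb, j, hj, ha, Or.inl rfl⟩⟩
    · exact ⟨(clauseAt cs j).2.1, Finset.mem_Icc.2 ⟨by omega, by omega⟩,
        Or.inr ⟨(clauseAt cs j).2.2, hb, j, hj, ha, Or.inr rfl⟩⟩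

/-- `x_i` loses to nobody but `d_i` in a game of non-negative value. -/
theorem eq_dMid_of_beats_xPl {n : ℕ} {cs : List Clause2} (hgood : Good23 n cs) {i a r : ℕ}
    (h1 : 1 ≤ i) (h2 : i ≤ n) (ha : xPl n i < a) (hv : gv2 n cs a (xPl n i) r ≠ -5) :
    a = dMid n i := by
  have hN := le_numP n
  have hm := hgood.two_mul_length_le
  unfold gv2 at hv
  split_ifs at hv with ho hz hd
  · obtain ⟨i', hi', ⟨-, h⟩ | ⟨s, -, j, hj, h, -⟩⟩ := OneGame.exists (r := r) hgood ha ho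
    · rw [Finset.mem_Icc] at hi'
      simp only [xPl, xTPl, xFPl] at h
      omega
    · simp only [xPl, cPl] at h
      omega
  · rcases hz with ⟨i', h1', h2', h, h'⟩ | ⟨i', h1', h2', h, h'⟩
    · simp only [xPl, dMid, dHat, dTil] at *
      omega
    · simp only [xPl, dMid, dHat, dTil] at *
      omega
  · exact absurd rfl hv
  · exact absurd (Or.inr ⟨i, h1, h2, Or.inr rfl⟩) hd

/-- `d_i` beats nobody but `d̃_i` and `x_i` in a game of non-negative value. -/
theorem eq_of_dMid_beats {n : ℕ} {cs : List Clause2} (hgood : Good23 n cs) {i c r : ℕ}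
    (h1 : 1 ≤ i) (h2 : i ≤ n) (hc : c < dMid n i) (hv : gv2 n cs (dMid n i) c r ≠ -5) :
    c = dTil n i ∨ c = xPl n i := by
  have hN := le_numP n
  have hm := hgood.two_mul_length_le
  unfold gv2 at hv
  split_ifs at hv with ho hz hd
  · obtain ⟨i', hi', ⟨h, -⟩ | ⟨s, h, -⟩⟩ := OneGame.exists (r := r) hgood hc ho
    · rw [Finset.mem_Icc] at hi'
      simp only [xPl, dMid] at h
      omega
    · rw [Finset.mem_Icc] at hi'
      simp only [litPl_eq, dMid] at h
      split_ifs at h <;> omega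
  · rcases hz with ⟨i', h1', h2', h, h'⟩ | ⟨i', h1', h2', h, h'⟩
    · simp only [xPl, dMid, dHat, dTil] at *
      omega
    · simp only [xPl, dMid, dHat, dTil] at *
      omega
  · exact absurd rfl hv
  · exact absurd (Or.inl ⟨i, h1, h2, Or.inl rfl⟩) hd

/-- The clause index of a lost game of a clause player. -/
def lostClause (n : ℕ) (g : ℕ × ℕ × ℕ) : ℕ := numP n - (6 * n + 1) - g.2.1

theorem LitGame.lostClause_spec {n : ℕ} {cs : List Clause2} (hgood : Good23 n cs) {p : ℕ × Bool}
    {g : ℕ × ℕ × ℕ} (h : LitGame n cs p g) :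
    lostClause n g < cs.length ∧ g.2.1 = cPl n (lostClause n g + 1) ∧
      ((clauseAt cs (lostClause n g)).1 = p ∨ (clauseAt cs (lostClause n g)).2 = p) := by
  obtain ⟨-, j, hj, hg, hc⟩ := h
  have hN := le_numP n
  have hm := hgood.two_mul_length_le
  have : lostClause n g = j := by
    rw [lostClause, hg, cPl]
    omega
  rw [this]
  exact ⟨hj, hg, hc⟩

section Counting

open Classical Finset

variable {n : ℕ} {cs : List Clause2} {l : List ℕ} {m : ℕ} {G : Finset (ℕ × ℕ × ℕ)}

theorem IsGameSet.lostClause_injOn (hG : IsGameSet m l G) (hgood : Good23 n cs)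
    (S : Finset (ℕ × ℕ × ℕ)) (hS : ∀ g ∈ S, g ∈ G ∧ ∃ p, LitGame n cs p g) :
    Set.InjOn (lostClause n) S := by
  intro g hg g' hg' h
  obtain ⟨hgG, p, hp⟩ := hS g hg
  obtain ⟨hgG', p', hp'⟩ := hS g' hg'
  have e : g.2.1 = g'.2.1 := by
    rw [(hp.lostClause_spec hgood).2.1, (hp'.lostClause_spec hgood).2.1, h]
  obtain ⟨a, b, r⟩ := g
  obtain ⟨a', b', r'⟩ := g'
  obtain rfl : b = b' := e
  obtain ⟨rfl, rfl⟩ := hG.loser_inj _ _ _ _ _ hgG hgG'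
  rfl

theorem IsGameSet.card_litGame_add_le (hG : IsGameSet m l G) (hgood : Good23 n cs) {i : ℕ}
    (h1 : 1 ≤ i) (h2 : i ≤ n) :
    #{g ∈ G | LitGame n cs (i, true) g} + #{g ∈ G | LitGame n cs (i, false) g} ≤ 3 := by
  rw [← card_union_of_disjoint]
  · refine le_trans ?_ (hgood.2 i h1 h2).2
    refine le_trans ?_ (countP_le_countP_lits i cs)
    rw [← card_filter_getD_eq_countP _ ((0, true), (0, true))]
    have key : ∀ g ∈ {g ∈ G | LitGame n cs (i, true) g} ∪ {g ∈ G | LitGame n cs (i, false) g},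
        g ∈ G ∧ ∃ s, LitGame n cs (i, s) g := by
      intro g hg
      simp only [mem_union, mem_filter] at hg
      rcases hg with hg | hg <;> exact ⟨hg.1, _, hg.2⟩
    refine card_le_card_of_injOn (lostClause n) ?_
      (hG.lostClause_injOn hgood _ fun g hg => ?_)
    · intro g hg
      obtain ⟨-, s, hs⟩ := key g hg
      obtain ⟨hj, -, hc⟩ := hs.lostClause_spec hgood
      simp only [coe_filter, mem_range, Set.mem_ofPred_eq, Bool.or_eq_true, beq_iff_eq]
      exact ⟨hj, hc.imp (congrArg Prod.fst) (congrArg Prod.fst)⟩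
    · obtain ⟨hgG, s, hs⟩ := key g hg
      exact ⟨hgG, _, hs⟩
  · rw [disjoint_left]
    intro g hg hg'
    have := litPl_inj (p := (i, true)) (q := (i, false)) ⟨h1, h2⟩ ⟨h1, h2⟩
      ((mem_filter.1 hg).2.1.symm.trans (mem_filter.1 hg').2.1)
    simp at this

theorem IsGameSet.card_varGame_le (hG : IsGameSet m l G) (i : ℕ) :
    #{g ∈ G | VarGame n i g} ≤ 2 := by
  refine le_trans (card_le_card_of_injOn (t := {xTPl n i, xFPl n i}) (fun g => g.2.1) ?_ ?_)
    card_le_two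
  · intro g hg
    simpa using (mem_filter.1 hg).2.2
  · rintro ⟨a, b, r⟩ hg ⟨a', b', r'⟩ hg' (rfl : b = b')
    obtain ⟨rfl, rfl⟩ := hG.loser_inj _ _ _ _ _ (mem_filter.1 hg).1 (mem_filter.1 hg').1
    rfl

/-- If no game of negative value involves `d_i` or `x_i`, then `x_i` loses in round `1` or `2`. -/
theorem IsGameSet.xPl_loses_early (hG : IsGameSet m l G) (hgood : Good23 n cs) {i : ℕ}
    (h1 : 1 ≤ i) (h2 : i ≤ n) (hl : ∀ p, p ∈ l ↔ p < numP n)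
    (hok : ∀ a b r, (a, b, r) ∈ G → gv2 n cs a b r = -5 → a ≠ dMid n i ∧ b ≠ xPl n i) :
    ∃ a r, (a, xPl n i, r) ∈ G ∧ r ≤ 2 := by
  have hN := le_numP n
  have hx : xPl n i < dMid n i := by
    unfold xPl dMid
    omega
  have hd : dMid n i < numP n := by
    unfold dMid
    omega
  have hne : xPl n i ≠ winner l := by
    have := le_winner ((hl _).2 hd)
    omega
  obtain ⟨a, r, har⟩ := hG.loses _ ((hl _).2 (hx.trans hd)) hne
  refine ⟨a, r, har, ?_⟩
  obtain rfl := eq_dMid_of_beats_xPl hgood h1 h2 (hG.bounds _ _ _ har).2.2.1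
    fun h => (hok _ _ _ har h).2 rfl
  by_contra! hr
  have key : ∀ r', 1 ≤ r' → r' < r → (dMid n i, dTil n i, r') ∈ G := by
    intro r' hr1 hr2
    obtain ⟨c, hc⟩ := hG.wins_before _ _ _ r' har hr1 hr2.le
    rcases eq_of_dMid_beats hgood h1 h2 (hG.bounds _ _ _ hc).2.2.1
      (fun h => (hok _ _ _ hc h).1 rfl) with rfl | rfl
    · exact hc
    · have := hG.loser_inj _ _ _ _ _ har hc
      omega
  have := hG.loser_inj _ _ _ _ _ (key 1 le_rfl (by omega)) (key 2 (by omega) (by omega))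
  omega

theorem IsGameSet.card_games_le (hG : IsGameSet m l G) (hgood : Good23 n cs) {i : ℕ}
    (h1 : 1 ≤ i) (h2 : i ≤ n) (hl : ∀ p, p ∈ l ↔ p < numP n)
    (hok : ∀ a b r, (a, b, r) ∈ G → gv2 n cs a b r = -5 → a ≠ dMid n i ∧ b ≠ xPl n i) :
    #{g ∈ G | VarGame n i g} + #{g ∈ G | LitGame n cs (i, true) g} +
        #{g ∈ G | LitGame n cs (i, false) g} ≤
      1 + max #{g ∈ G | LitGame n cs (i, true) g} #{g ∈ G | LitGame n cs (i, false) g} := by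
  obtain ⟨a, r, har, hr⟩ := hG.xPl_loses_early hgood h1 h2 hl hok
  have h3 := hG.card_litGame_add_le hgood h1 h2
  have hround : ∀ b r', (xPl n i, b, r') ∈ G → r' = 1 := by
    intro b r' h
    have := hG.lt_of_loses _ _ _ _ _ har h
    have := (hG.bounds _ _ _ h).2.2.2.1
    omega
  have hX : #{g ∈ G | VarGame n i g} ≤ 1 := by
    rw [card_le_one]
    rintro ⟨a, b, r⟩ hg ⟨a', b', r'⟩ hg'
    obtain ⟨hg, rfl, -⟩ := mem_filter.1 hg
    obtain ⟨hg', rfl, -⟩ := mem_filter.1 hg'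
    obtain rfl := hround _ _ hg
    obtain rfl := hround _ _ hg'
    obtain rfl := hG.winner_inj _ _ _ _ hg hg'
    rfl
  rcases Finset.eq_empty_or_nonempty {g ∈ G | VarGame n i g} with h0 | ⟨⟨a', b, r'⟩, hg⟩
  · rw [h0, card_empty]
    omega
  · obtain ⟨hg, rfl, hb⟩ := mem_filter.1 hg
    obtain rfl := hround _ _ hg
    have hlit : ∃ s, b = litPl n (i, s) := by
      rcases hb with rfl | rfl
      · exact ⟨true, by simp [litPl]⟩
      · exact ⟨false, by simp [litPl]⟩
    obtain ⟨s, rfl⟩ := hlit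
    have h0 : #{g ∈ G | LitGame n cs (i, s) g} = 0 := by
      rw [card_eq_zero, filter_eq_empty_iff]
      rintro ⟨a', b, r'⟩ hg' ⟨rfl, -⟩
      have := hG.lt_of_loses _ _ _ _ _ hg hg'
      have := (hG.bounds _ _ _ hg').2.2.2.1
      omega
    cases s <;> omega

theorem IsGameSet.sum_gv2_le (hG : IsGameSet m l G) (hgood : Good23 n cs) :
    ∑ g ∈ G, gv2 n cs g.1 g.2.1 g.2.2 ≤
      ∑ i ∈ Icc 1 n, (((#{g ∈ G | VarGame n i g} + #{g ∈ G | LitGame n cs (i, true) g} +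
        #{g ∈ G | LitGame n cs (i, false) g} : ℕ)) : ℤ) -
      5 * (#{g ∈ G | gv2 n cs g.1 g.2.1 g.2.2 = -5} : ℤ) := by
  simp only [card_filter, ← sum_add_distrib, Nat.cast_sum]
  rw [sum_comm, mul_sum, ← sum_sub_distrib]
  refine sum_le_sum ?_
  rintro ⟨a, b, r⟩ hg
  have hab := (hG.bounds _ _ _ hg).2.2.1
  set F : ℕ → ℤ := fun i => (((if VarGame n i (a, b, r) then 1 else 0) +
      (if LitGame n cs (i, true) (a, b, r) then 1 else 0) +
      (if LitGame n cs (i, false) (a, b, r) then 1 else 0) : ℕ) : ℤ) with hF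
  have hnn : ∀ i ∈ Icc 1 n, 0 ≤ F i := fun i _ => Nat.cast_nonneg _
  have hs := sum_nonneg hnn
  by_cases ho : OneGame n cs a b ∨ OneGame n cs b a
  · obtain ⟨i, hi, h⟩ := OneGame.exists (r := r) hgood hab ho
    have hv : gv2 n cs a b r = 1 := by simp [gv2, ho]
    have h1 : 1 ≤ F i := by
      simp only [hF]
      norm_cast
      rcases h with h | ⟨_ | _, h⟩ <;> simp only [h, if_true] <;> omega
    have := single_le_sum hnn hi
    simp only [hv]
    norm_num
    exact h1.trans this
  · have hv : gv2 n cs a b r = 0 ∨ gv2 n cs a b r = -5 := by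
      unfold gv2
      split_ifs <;> simp
    rcases hv with hv | hv <;> simp only [hv] <;> norm_num <;> exact hs

theorem IsGameSet.sum_max_le_satCount (hG : IsGameSet m l G) (hgood : Good23 n cs)
    (α : ℕ → Bool) :
    ∑ i ∈ Icc 1 n, #{g ∈ G | LitGame n cs (i, α i) g} ≤ satCount α cs := by
  rw [← card_biUnion, satCount, ← card_filter_getD_eq_countP _ ((0, true), (0, true))]
  · have key : ∀ g ∈ (Icc 1 n).biUnion fun i => {g ∈ G | LitGame n cs (i, α i) g},
        g ∈ G ∧ ∃ i, LitGame n cs (i, α i) g := by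
      intro g hg
      obtain ⟨i, -, h⟩ := mem_biUnion.1 hg
      exact ⟨(mem_filter.1 h).1, i, (mem_filter.1 h).2⟩
    refine card_le_card_of_injOn (lostClause n) ?_
      (hG.lostClause_injOn hgood _ fun g hg => ?_)
    · intro g hg
      obtain ⟨-, i, h⟩ := key g hg
      obtain ⟨hj, -, hc⟩ := h.lostClause_spec hgood
      simp only [coe_filter, mem_range, Set.mem_ofPred_eq]
      refine ⟨hj, ?_⟩
      change clauseSat α (clauseAt cs (lostClause n g)) = true
      unfold clauseSat
      rcases hc with hc | hc <;> rw [hc] <;> simp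
    · obtain ⟨hgG, i, h⟩ := key g hg
      exact ⟨hgG, _, h⟩
  · intro i hi i' hi' hne
    rw [Function.onFun, Finset.disjoint_left]
    intro g hg hg'
    have := litPl_inj (p := (i, α i)) (q := (i', α i')) (by simpa using hi) (by simpa using hi')
      ((mem_filter.1 hg).2.1.symm.trans (mem_filter.1 hg').2.1)
    exact hne (congrArg Prod.fst this)

/-- Every game involves `d_i` or `x_i` for at most two indices `i`. -/
theorem card_touched_le (B : Finset (ℕ × ℕ × ℕ)) :
    #{i ∈ Icc 1 n | ∃ g ∈ B, g.1 = dMid n i ∨ g.2.1 = xPl n i} ≤ #B * 2 := by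
  refine le_trans (card_le_card ?_) (card_biUnion_le_card_mul B
    (fun g => {dxIndex n g.1, dxIndex n g.2.1}) 2 fun g _ => card_le_two)
  intro i hi
  simp only [mem_filter, mem_Icc] at hi
  obtain ⟨⟨h1, h2⟩, g, hg, h⟩ := hi
  refine mem_biUnion.2 ⟨g, hg, ?_⟩
  rcases h with h | h <;> rw [h]
  · simp [dxIndex_dMid h1 h2]
  · simp [dxIndex_xPl h1 h2]

end Counting

/-- If the Construction 2 instance `T_φ` admits a seeding of
tournament value at least `k + n`, then the (2,3)-CNF formula `φ` admits an
assignment satisfying at least `k` clauses. -/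
theorem stmt_9 (n k : ℕ) (cs : List Clause2) (hgood : Good23 n cs)
    (l : List ℕ) (hl : IsSeeding (Finset.range (numP n)) l)
    (hval : ((k : ℤ) + n) ≤ tourValue (gv2 n cs) (Nat.clog 2 (16 * n)) l) :
    ∃ α : ℕ → Bool, k ≤ satCount α cs := by
  classical
  obtain ⟨hnd, hset⟩ := hl
  have hlen : l.length = 2 ^ Nat.clog 2 (16 * n) := by
    rw [← List.toFinset_card_of_nodup hnd, hset, Finset.card_range, numP]
  have hmem : ∀ p, p ∈ l ↔ p < numP n := by
    intro p
    rw [← List.mem_toFinset, hset, Finset.mem_range]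
  obtain ⟨hG, hsum⟩ := tourGames_spec (gv2 n cs) (gv2_comm n cs) _ l hnd hlen
  rw [hsum] at hval
  generalize tourGames (Nat.clog 2 (16 * n)) l = G at hG hval
  have hval := hval.trans (hG.sum_gv2_le hgood)
  let X : ℕ → ℕ := fun i => (G.filter (VarGame n i)).card
  let T : ℕ → ℕ := fun i => (G.filter (LitGame n cs (i, true))).card
  let F : ℕ → ℕ := fun i => (G.filter (LitGame n cs (i, false))).card
  let B := G.filter (fun g => gv2 n cs g.1 g.2.1 g.2.2 = -5)
  let touched : ℕ → Prop := fun i => ∃ g ∈ B, g.1 = dMid n i ∨ g.2.1 = xPl n i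
  refine ⟨fun i => decide (F i ≤ T i), ?_⟩
  have hsat := hG.sum_max_le_satCount hgood (fun i => decide (F i ≤ T i))
  have hmax : ∀ i, (G.filter (LitGame n cs (i, decide (F i ≤ T i)))).card = max (T i) (F i) := by
    intro i
    by_cases h : F i ≤ T i
    · rw [decide_eq_true h, max_eq_left h]
    · rw [decide_eq_false h, max_eq_right (by omega)]
  simp only [hmax] at hsat
  have hbound : ∀ i ∈ Finset.Icc 1 n, X i + T i + F i ≤
      1 + max (T i) (F i) + 2 * if touched i then 1 else 0 := by
    intro i hi
    rw [Finset.mem_Icc] at hi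
    split_ifs with ht
    · have h2 : X i ≤ 2 := hG.card_varGame_le i
      have h3 : T i + F i ≤ 3 := hG.card_litGame_add_le hgood hi.1 hi.2
      omega
    · refine hG.card_games_le hgood hi.1 hi.2 hmem fun a b r hg hb => ?_
      constructor <;> rintro rfl <;>
        exact ht ⟨_, Finset.mem_filter.2 ⟨hg, hb⟩, by simp⟩
  have htot := Finset.sum_le_sum hbound
  rw [Finset.sum_add_distrib (f := fun i => 1 + max (T i) (F i)),
    Finset.sum_add_distrib (f := fun _ => 1), ← Finset.mul_sum] at htot
  have htouched : (∑ i ∈ Finset.Icc 1 n, if touched i then 1 else 0) ≤ B.card * 2 := by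
    rw [← Finset.card_filter]
    convert card_touched_le B
  simp only [Finset.sum_const, Nat.card_Icc, smul_eq_mul, add_tsub_cancel_right, mul_one] at htot
  rw [← Nat.cast_sum] at hval
  change _ ≤ ((∑ i ∈ Finset.Icc 1 n, (X i + T i + F i) : ℕ) : ℤ) -
    5 * (B.card : ℤ) at hval
  omega
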